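/- If ρ = Σᵢ pᵢ (xⁱ(xⁱ)†) ⊗ (yⁱ(yⁱ)†) is a separable bipartite state with pᵢ ≥ 0 and ‖yⁱ‖ = 1, then the vector of eigenvalues of ρ is majorized by the vector of eigenvalues of its first marginal ρ₁ = Σᵢ pᵢ xⁱ(xⁱ)†. -/

import Mathlib

open scoped InnerProductSpace

lemma aux_bessel {n : Type*} [Fintype n] [DecidableEq n] {m : ℕ}
    (G : n → EuclideanSpace ℂ (Fin m)) (h0 : ∀ i j, i ≠ j → inner ℂ (G i) (G j) = 0)
    (h1 : ∀ j, G j = 0 ∨ ‖G j‖ = 1) (s : Finset n) (z : EuclideanSpace ℂ (Fin m)) :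
    ∑ j ∈ s, ‖inner ℂ (G j) z‖ ^ 2 ≤ ‖z‖ ^ 2 := by
  classical
  have ho : Orthonormal ℂ (fun j : {j : n // ‖G j‖ = 1} => G j) := by
    refine ⟨fun j => j.2, fun i j hij => h0 _ _ ?_⟩
    exact fun h => hij (Subtype.ext h)
  have hb := ho.sum_inner_products_le z (s := Finset.univ)
  refine le_trans ?_ hb
  calc ∑ j ∈ s, ‖inner ℂ (G j) z‖ ^ 2 ≤ ∑ j, ‖inner ℂ (G j) z‖ ^ 2 :=
        Finset.sum_le_sum_of_subset_of_nonneg (Finset.subset_univ _) (fun _ _ _ => by positivity)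
    _ = ∑ j ∈ Finset.univ.filter (fun j => ‖G j‖ = 1), ‖inner ℂ (G j) z‖ ^ 2 := by
        symm
        apply Finset.sum_subset (Finset.subset_univ _)
        intro j _ hj
        rcases h1 j with h | h
        · simp [h]
        · simp [h] at hj
    _ ≤ _ := by
        rw [Finset.sum_subtype (p := fun j => ‖G j‖ = 1)
          (Finset.univ.filter (fun j => ‖G j‖ = 1)) (by simp)]

lemma aux_factor {n : Type*} [Fintype n] [DecidableEq n] {m : ℕ}
    (M : Matrix n n ℂ) (hM : M.IsHermitian) (a : Fin m → n → ℂ)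
    (hMa : ∀ s t, M s t = ∑ i, a i s * star (a i t)) :
    ∃ G : n → EuclideanSpace ℂ (Fin m),
      (∀ j, 0 ≤ hM.eigenvalues j) ∧
      (∀ i j, i ≠ j → inner ℂ (G i) (G j) = 0) ∧
      (∀ j, (G j = 0 ∧ hM.eigenvalues j = 0) ∨ ‖G j‖ = 1) ∧
      ∀ z : Fin m → ℂ, ∑ s, ‖∑ i, z i * a i s‖ ^ 2
        = ∑ j, hM.eigenvalues j * ‖inner ℂ (G j) (WithLp.toLp 2 z)‖ ^ 2 := by
  classical
  set f := hM.eigenvectorBasis with hf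
  let b : n → EuclideanSpace ℂ (Fin m) := fun j =>
    WithLp.toLp 2 (fun i => inner ℂ (WithLp.toLp 2 (a i) : EuclideanSpace ℂ n) (f j))
  have hb : ∀ j l, inner ℂ (b j) (b l) = if j = l then (hM.eigenvalues l : ℂ) else 0 := by
    intro j l
    have h1 : inner ℂ (f j) (WithLp.toLp 2 (M.mulVec (f l)) : EuclideanSpace ℂ n)
        = if j = l then (hM.eigenvalues l : ℂ) else 0 := by
      rw [hf, hM.mulVec_eigenvectorBasis l]
      have : (WithLp.toLp 2 (hM.eigenvalues l • (hM.eigenvectorBasis l : n → ℂ)) :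
          EuclideanSpace ℂ n) = (hM.eigenvalues l : ℂ) • hM.eigenvectorBasis l := by
        ext s; simp
      rw [this, inner_smul_right, orthonormal_iff_ite.mp hM.eigenvectorBasis.orthonormal]
      simp
    rw [← h1]
    have h2 : (WithLp.toLp 2 (M.mulVec (f l)) : EuclideanSpace ℂ n)
        = ∑ i, b l i • (WithLp.toLp 2 (a i) : EuclideanSpace ℂ n) := by
      ext s
      simp only [b, PiLp.inner_apply, RCLike.inner_apply, Matrix.mulVec, dotProduct, hMa,
        WithLp.ofLp_sum, WithLp.ofLp_smul, Finset.sum_apply, Pi.smul_apply, smul_eq_mul,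
        Finset.sum_mul]
      rw [Finset.sum_comm]
      refine Finset.sum_congr rfl fun i _ => Finset.sum_congr rfl fun t _ => ?_
      rw [starRingEnd_apply]; ring
    rw [h2, inner_sum, PiLp.inner_apply]
    refine Finset.sum_congr rfl fun i _ => ?_
    rw [inner_smul_right]
    simp only [b, RCLike.inner_apply, inner_conj_symm]
  have hnn : ∀ j, 0 ≤ hM.eigenvalues j := by
    intro j
    have h := hb j j
    rw [if_pos rfl, inner_self_eq_norm_sq_to_K] at h
    have : ‖b j‖ ^ 2 = hM.eigenvalues j := by
      apply Complex.ofReal_injective; push_cast; exact h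
    rw [← this]; positivity
  have hbn : ∀ j, ‖b j‖ ^ 2 = hM.eigenvalues j := by
    intro j
    have h := hb j j
    rw [if_pos rfl, inner_self_eq_norm_sq_to_K] at h
    apply Complex.ofReal_injective; push_cast; exact h
  refine ⟨fun j => ((Real.sqrt (hM.eigenvalues j))⁻¹ : ℂ) • b j, hnn, ?_, ?_, ?_⟩
  · intro i j hij
    rw [inner_smul_left, inner_smul_right, hb, if_neg hij]; simp
  · intro j
    by_cases h : hM.eigenvalues j = 0
    · left; simp [h]
    · right
      rw [norm_smul]
      have h2 : ‖b j‖ = Real.sqrt (hM.eigenvalues j) := by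
        rw [← hbn, Real.sqrt_sq (norm_nonneg _)]
      have h3 : Real.sqrt (hM.eigenvalues j) ≠ 0 := by
        rw [Real.sqrt_ne_zero (hnn j)]; exact h
      rw [h2, norm_inv, Complex.norm_real, Real.norm_of_nonneg (Real.sqrt_nonneg _)]
      field_simp
  · intro z
    let v : EuclideanSpace ℂ n := WithLp.toLp 2 (fun s => ∑ i, z i * a i s)
    have hv : v = ∑ i, z i • (WithLp.toLp 2 (a i) : EuclideanSpace ℂ n) := by
      ext s; simp [v]
    have e1 : ∑ s, ‖∑ i, z i * a i s‖ ^ 2 = ‖v‖ ^ 2 := by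
      rw [EuclideanSpace.norm_sq_eq]
    rw [e1, ← f.sum_sq_norm_inner_right v]
    apply Finset.sum_congr rfl
    intro j _
    have e2 : inner ℂ (f j) v = inner ℂ (b j) (WithLp.toLp 2 z : EuclideanSpace ℂ (Fin m)) := by
      rw [hv, inner_sum]
      rw [PiLp.inner_apply]
      apply Finset.sum_congr rfl
      intro i _
      rw [inner_smul_right]
      simp only [b, RCLike.inner_apply, inner_conj_symm]
    rw [e2, inner_smul_left, norm_mul, mul_pow]
    by_cases h : hM.eigenvalues j = 0
    · have : b j = 0 := by
        have := hbn j
        rw [h] at this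
        simpa using this
      simp [this]
    · have h4 : ‖(starRingEnd ℂ) ((Real.sqrt (hM.eigenvalues j) : ℂ))⁻¹‖ ^ 2
          = (hM.eigenvalues j)⁻¹ := by
        rw [RCLike.norm_conj, norm_inv, Complex.norm_real,
          Real.norm_of_nonneg (Real.sqrt_nonneg _), inv_pow, Real.sq_sqrt (hnn j)]
      rw [h4]; field_simp

lemma aux_knapsack {α : Type*} [Fintype α] [DecidableEq α] (u c : α → ℝ) (hu : ∀ i, 0 ≤ u i)
    (hc0 : ∀ i, 0 ≤ c i) (hc1 : ∀ i, c i ≤ 1) (k : ℕ) (hk : k ≤ Fintype.card α)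
    (hc : ∑ i, c i ≤ k) : ∃ T : Finset α, T.card = k ∧ ∑ i, c i * u i ≤ ∑ i ∈ T, u i := by
  obtain ⟨T, hT, hmax⟩ := Finset.exists_max_image
    (Finset.powersetCard k (Finset.univ : Finset α)) (fun T => ∑ i ∈ T, u i)
    (Finset.powersetCard_nonempty.mpr (by simpa using hk))
  have hTk : T.card = k := (Finset.mem_powersetCard.mp hT).2
  refine ⟨T, hTk, ?_⟩
  rcases T.eq_empty_or_nonempty with hE | hne
  · subst hE
    have hk0 : k = 0 := by simpa using hTk.symm
    subst hk0
    have hz : ∑ i, c i = 0 := le_antisymm (by simpa using hc) (Finset.sum_nonneg fun i _ => hc0 i)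
    have hz' := (Finset.sum_eq_zero_iff_of_nonneg (fun i _ => hc0 i)).mp hz
    rw [Finset.sum_eq_zero]
    · simp
    · intro i hi; rw [hz' i hi, zero_mul]
  · obtain ⟨i0, hi0, hmin⟩ := Finset.exists_min_image T u hne
    have hoff : ∀ j, j ∉ T → u j ≤ u i0 := by
      intro j hj
      have hj' : j ∉ T.erase i0 := fun h => hj (Finset.mem_of_mem_erase h)
      have := hmax (insert j (T.erase i0)) (by
        rw [Finset.mem_powersetCard]
        refine ⟨Finset.subset_univ _, ?_⟩
        rw [Finset.card_insert_of_notMem hj', Finset.card_erase_of_mem hi0, hTk]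
        have : 0 < T.card := Finset.card_pos.mpr hne
        omega)
      rw [Finset.sum_insert hj', ← Finset.add_sum_erase T u hi0] at this
      linarith
    have h1 : ∑ i, c i * (u i - u i0) ≤ ∑ i ∈ T, (u i - u i0) := by
      rw [← Finset.sum_subset (Finset.subset_univ T)
        (f := fun i => if i ∈ T then u i - u i0 else 0) (fun i _ h => by simp [h]) |>.symm.trans
        (Finset.sum_congr rfl fun i hi => by simp [hi]) |>.symm.symm]
      apply Finset.sum_le_sum
      intro i _
      by_cases h : i ∈ T
      · have := hmin i h
        simp only [h, if_true]
        nlinarith [hc1 i]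
      · have := hoff i h
        simp only [h, if_false]
        nlinarith [hc0 i]
    have h2 : ∑ i, c i * u i = ∑ i, c i * (u i - u i0) + u i0 * ∑ i, c i := by
      rw [Finset.mul_sum, ← Finset.sum_add_distrib]
      exact Finset.sum_congr rfl fun i _ => by ring
    have h3 : ∑ i ∈ T, (u i - u i0) = ∑ i ∈ T, u i - k * u i0 := by
      rw [Finset.sum_sub_distrib]; simp [hTk]
    have := mul_le_mul_of_nonneg_left hc (hu i0)
    rw [h2]; linarith


/-- The sum of the `k` largest entries of `u` (the largest sum over subsets of size `k`). -/
noncomputable def topSum {α : Type*} [Fintype α] [DecidableEq α] (u : α → ℝ) (k : ℕ) : ℝ :=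
  sSup {t : ℝ | ∃ s : Finset α, s.card = k ∧ t = ∑ i ∈ s, u i}

/-- A separable bipartite state is more disordered globally than locally: the eigenvalues
of `ρ = ∑ᵢ pᵢ xⁱ(xⁱ)† ⊗ yⁱ(yⁱ)†` (with `pᵢ ≥ 0` and `yⁱ` normalized) are majorized by
the eigenvalues of its first marginal `ρ₁ = ∑ᵢ pᵢ xⁱ(xⁱ)†` (padded with zeros). -/
theorem separable_eigenvalues_majorized_by_marginal {d₁ d₂ m : ℕ} [NeZero d₂]
    (p : Fin m → ℝ) (hp : ∀ i, 0 ≤ p i)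
    (x : Fin m → Fin d₁ → ℂ) (y : Fin m → Fin d₂ → ℂ)
    (hy : ∀ i, ∑ k, ‖y i k‖ ^ 2 = 1)
    (ρ : Matrix (Fin d₁ × Fin d₂) (Fin d₁ × Fin d₂) ℂ)
    (hρdef : ρ = ∑ i, (p i : ℂ) •
      Matrix.kroneckerMap (· * ·)
        (Matrix.of fun a b : Fin d₁ => x i a * star (x i b))
        (Matrix.of fun a b : Fin d₂ => y i a * star (y i b)))
    (ρ₁ : Matrix (Fin d₁) (Fin d₁) ℂ)
    (hρ₁def : ρ₁ = ∑ i, (p i : ℂ) • Matrix.of fun a b : Fin d₁ => x i a * star (x i b))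
    (hρ : ρ.IsHermitian) (hρ₁ : ρ₁.IsHermitian) :
    (∀ k : ℕ,
      topSum hρ.eigenvalues k ≤
        topSum (fun q : Fin d₁ × Fin d₂ => if q.2 = 0 then hρ₁.eigenvalues q.1 else 0) k) ∧
    ∑ q, hρ.eigenvalues q = ∑ i, hρ₁.eigenvalues i := by
  classical
  let a : Fin m → Fin d₁ → ℂ := fun i s => (Real.sqrt (p i) : ℂ) * x i s
  have hsq : ∀ i, (Real.sqrt (p i) : ℂ) * (Real.sqrt (p i) : ℂ) = (p i : ℂ) := by
    intro i; rw [← Complex.ofReal_mul, Real.mul_self_sqrt (hp i)]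
  have h₁ : ∀ s t, ρ₁ s t = ∑ i, a i s * star (a i t) := by
    intro s t
    rw [hρ₁def, Matrix.sum_apply]
    refine Finset.sum_congr rfl fun i _ => ?_
    simp only [a, Matrix.smul_apply, Matrix.of_apply, smul_eq_mul, ← hsq, star_mul',
      Complex.star_def, Complex.conj_ofReal]
    ring
  have h₂ : ∀ s t, ρ s t = ∑ i, (a i s.1 * y i s.2) * star (a i t.1 * y i t.2) := by
    intro s t
    rw [hρdef, Matrix.sum_apply]
    refine Finset.sum_congr rfl fun i _ => ?_
    simp only [a, Matrix.smul_apply, Matrix.kroneckerMap_apply, Matrix.of_apply, smul_eq_mul,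
      ← hsq, star_mul', Complex.star_def, Complex.conj_ofReal]
    ring
  have hy' : ∀ i, ∑ k, y i k * star (y i k) = 1 := by
    intro i
    have : ∀ k, y i k * star (y i k) = ((‖y i k‖ ^ 2 : ℝ) : ℂ) := by
      intro k
      rw [Complex.star_def, Complex.mul_conj, Complex.normSq_eq_norm_sq]
    simp only [this]
    rw [← Complex.ofReal_sum, hy i, Complex.ofReal_one]
  constructor
  swap
  · have t1 := hρ.trace_eq_sum_eigenvalues
    have t2 := hρ₁.trace_eq_sum_eigenvalues
    have t3 : ρ.trace = ρ₁.trace := by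
      simp only [Matrix.trace, Matrix.diag, h₁, h₂]
      rw [Fintype.sum_prod_type]
      refine Finset.sum_congr rfl fun s _ => ?_
      rw [Finset.sum_comm]
      refine Finset.sum_congr rfl fun i _ => ?_
      calc ∑ k, a i s * y i k * star (a i s * y i k)
          = ∑ k, a i s * star (a i s) * (y i k * star (y i k)) :=
            Finset.sum_congr rfl fun k _ => by rw [star_mul']; ring
        _ = _ := by rw [← Finset.mul_sum, hy' i, mul_one]
    rw [t1, t2] at t3
    exact_mod_cast t3
  obtain ⟨g, hl0, hgo, hgn, hg⟩ := aux_factor ρ₁ hρ₁ a h₁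
  obtain ⟨w, hr0, hwo, hwn, hw⟩ := aux_factor ρ hρ (fun i s => a i s.1 * y i s.2) h₂
  have hgn' : ∀ j, g j = 0 ∨ ‖g j‖ = 1 := fun j => (hgn j).imp_left And.left
  have hwn' : ∀ j, w j = 0 ∨ ‖w j‖ = 1 := fun j => (hwn j).imp_left And.left
  let Y : Fin d₂ → EuclideanSpace ℂ (Fin m) → EuclideanSpace ℂ (Fin m) :=
    fun k z => WithLp.toLp 2 (fun i => z i * y i k)
  let Z : Fin d₂ → EuclideanSpace ℂ (Fin m) → EuclideanSpace ℂ (Fin m) :=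
    fun k z => WithLp.toLp 2 (fun i => z i * star (y i k))
  have hY : ∀ z, ∑ k, ‖Y k z‖ ^ 2 = ‖z‖ ^ 2 := by
    intro z
    simp only [EuclideanSpace.norm_sq_eq, Y, norm_mul, mul_pow]
    rw [Finset.sum_comm]
    refine Finset.sum_congr rfl fun i _ => ?_
    rw [← Finset.mul_sum, hy i, mul_one]
  have hZ : ∀ z, ∑ k, ‖Z k z‖ ^ 2 = ‖z‖ ^ 2 := by
    intro z
    simp only [EuclideanSpace.norm_sq_eq, Z, norm_mul, mul_pow, norm_star]
    rw [Finset.sum_comm]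
    refine Finset.sum_congr rfl fun i _ => ?_
    rw [← Finset.mul_sum, hy i, mul_one]
  have hYZ : ∀ k z z', ‖inner ℂ z (Y k z')‖ = ‖inner ℂ z' (Z k z)‖ := by
    intro k z z'
    rw [norm_inner_symm]
    have : inner ℂ (Y k z') z = inner ℂ z' (Z k z) := by
      simp only [PiLp.inner_apply, RCLike.inner_apply, Y, Z]
      refine Finset.sum_congr rfl fun i _ => ?_
      simp only [map_mul, Complex.star_def]
      ring
    rw [this]
  let D : Fin d₁ × Fin d₂ → Fin d₁ → ℝ := fun q j => ∑ k, ‖inner ℂ (g j) (Y k (w q))‖ ^ 2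
  have hD0 : ∀ q j, 0 ≤ D q j := fun q j => Finset.sum_nonneg fun _ _ => by positivity
  have hnorm : ∀ {n : Type} (G : n → EuclideanSpace ℂ (Fin m)) (j : n),
      (G j = 0 ∨ ‖G j‖ = 1) → ‖G j‖ ^ 2 ≤ 1 := by
    intro n G j h
    rcases h with h | h <;> simp [h]
  have hrow : ∀ q, ∑ j, D q j ≤ 1 := by
    intro q
    simp only [D]
    rw [Finset.sum_comm]
    calc _ ≤ ∑ k, ‖Y k (w q)‖ ^ 2 :=
          Finset.sum_le_sum fun k _ => aux_bessel g hgo hgn' Finset.univ _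
      _ = ‖w q‖ ^ 2 := hY _
      _ ≤ 1 := hnorm w q (hwn' q)
  have hcol : ∀ (S : Finset (Fin d₁ × Fin d₂)) j, ∑ q ∈ S, D q j ≤ 1 := by
    intro S j
    simp only [D, hYZ]
    rw [Finset.sum_comm]
    calc _ ≤ ∑ k, ‖Z k (g j)‖ ^ 2 :=
          Finset.sum_le_sum fun k _ => aux_bessel w hwo hwn' S _
      _ = ‖g j‖ ^ 2 := hZ _
      _ ≤ 1 := hnorm g j (hgn' j)
  have hr : ∀ q, hρ.eigenvalues q = ∑ j, hρ₁.eigenvalues j * D q j := by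
    intro q
    have e1 := hw (fun i => w q i)
    have e2 : ∑ l, hρ.eigenvalues l *
        ‖inner ℂ (w l) (WithLp.toLp 2 (fun i => w q i) : EuclideanSpace ℂ (Fin m))‖ ^ 2
        = hρ.eigenvalues q := by
      have e3 : (WithLp.toLp 2 (fun i => w q i) : EuclideanSpace ℂ (Fin m)) = w q := rfl
      rw [e3, Finset.sum_eq_single q]
      · rcases hwn q with h | h
        · simp [h.2]
        · rw [inner_self_eq_norm_sq_to_K, h]; simp
      · intro l _ hl
        rw [hwo l q hl]; simp
      · simp
    rw [e2] at e1
    rw [← e1, Fintype.sum_prod_type, Finset.sum_comm]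
    have e4 : ∀ k, ∑ s, ‖∑ i, w q i * (a i s * y i k)‖ ^ 2
        = ∑ j, hρ₁.eigenvalues j * ‖inner ℂ (g j) (Y k (w q))‖ ^ 2 := by
      intro k
      rw [← hg (fun i => w q i * y i k)]
      refine Finset.sum_congr rfl fun s _ => ?_
      congr 2
      exact Finset.sum_congr rfl fun i _ => by ring
    simp only [e4, D, Finset.mul_sum]
    rw [Finset.sum_comm]
  intro k
  unfold topSum
  by_cases hk : k ≤ Fintype.card (Fin d₁ × Fin d₂)
  swap
  · have he : ∀ u : Fin d₁ × Fin d₂ → ℝ,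
        {t : ℝ | ∃ s : Finset (Fin d₁ × Fin d₂), s.card = k ∧ t = ∑ i ∈ s, u i} = ∅ := by
      intro u
      ext t
      simp only [Set.mem_ofPred_eq, Set.mem_empty_iff_false, iff_false]
      rintro ⟨s, hs, _⟩
      exact hk (hs ▸ Finset.card_le_univ s)
    rw [he, he]
  apply csSup_le
  · obtain ⟨s, _, hs⟩ := Finset.exists_subset_card_eq
      (s := (Finset.univ : Finset (Fin d₁ × Fin d₂))) (by simpa using hk)
    exact ⟨_, s, hs, rfl⟩
  rintro t ⟨S, hS, rfl⟩
  obtain ⟨T, hT, hle⟩ := aux_knapsack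
    (fun q : Fin d₁ × Fin d₂ => if q.2 = 0 then hρ₁.eigenvalues q.1 else 0)
    (fun q => if q.2 = 0 then ∑ q' ∈ S, D q' q.1 else 0)
    (fun q => by split_ifs; exacts [hl0 _, le_rfl])
    (fun q => by
      split_ifs
      exacts [Finset.sum_nonneg fun _ _ => hD0 _ _, le_rfl])
    (fun q => by split_ifs; exacts [hcol _ _, zero_le_one])
    k hk (by
      rw [Fintype.sum_prod_type]
      simp only [Finset.sum_ite_eq', Finset.mem_univ, if_true]
      rw [Finset.sum_comm]
      calc _ ≤ ∑ q ∈ S, (1 : ℝ) := Finset.sum_le_sum fun q _ => hrow q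
        _ = k := by simp [hS])
  refine le_trans ?_ (le_trans hle (le_csSup ?_ ⟨T, hT, rfl⟩))
  · rw [Fintype.sum_prod_type]
    simp only [hr, mul_ite, ite_mul, zero_mul, mul_zero]
    rw [Finset.sum_comm]
    apply le_of_eq
    refine Finset.sum_congr rfl fun j _ => ?_
    rw [← Finset.mul_sum, mul_comm]
    simp
  · apply Set.Finite.bddAbove
    apply (Set.finite_range (fun s : Finset (Fin d₁ × Fin d₂) => ∑ q ∈ s,
      (if q.2 = 0 then hρ₁.eigenvalues q.1 else 0))).subset
    rintro t ⟨s, _, rfl⟩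
    exact ⟨s, rfl⟩
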